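/- Let N, M, K, H be positive integers, ε ≥ 0, ν > 0, η > 0. Let U ∈ ℝ^{N×M} have nonnegative entries, let V^1, …, V^K ∈ ℝ^{N×M}, and set L = 2η max_{k∈[K]} ‖V^k‖₁. Let a_0, a_1, a_2, … be nonnegative weights with a_0 > 0, and for leader strategies x^1,…,x^H define b_t, z^t, θ_t, Θ_H as in the context. Let g^1, …, g^H ∈ {e_1,…,e_K} with G^t = Σ_{τ=1}^t g^τ, G^0 = 0. Let σ = (σ_1,…,σ_N) have i.i.d. coordinates exponentially distributed with rate ν, and suppose x^1, …, x^H are measurable Δ_N-valued functions of σ such that for every σ ∈ ℝ^N_{≥0} and every t ∈ {1,…,H}, ⟨𝒴_QR(x^t(σ))ᵀ Uᵀ x^t(σ), G^{t−1}⟩ + ⟨σ, x^t(σ)⟩ ≥ max_{x∈Δ_N} [⟨𝒴_QR(x)ᵀ Uᵀ x, G^{t−1}⟩ + ⟨σ, x⟩] − ε. Then E[ max_{x∈Δ_N} ⟨𝒴_QR(x)ᵀ Uᵀ x, G^H⟩ − Σ_{t=1}^H ⟨𝒴_QR(z^t)ᵀ Uᵀ x^t, g^t⟩ ] ≤ 50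 ν N² ‖U‖₁² (1+L)² (H + Θ_H) + N/ν + ε(13H + 1), where the expectation is over σ. -/

import Mathlib

open MeasureTheory

/-- The law of a random vector in `ℝ^N` whose coordinates are i.i.d. exponential with rate `ν`. -/
noncomputable def expPi (N : ℕ) (ν : ℝ) : Measure (Fin N → ℝ) :=
  Measure.pi fun _ => ProbabilityTheory.expMeasure ν

/-- The quantal response map: `(qr η V x) i = exp(η⟨V_i, x⟩) / ∑_j exp(η⟨V_j, x⟩)`,
where `V_i` is the `i`-th column of `V ∈ ℝ^{N×M}`. -/
noncomputable def qr {N M : ℕ} (η : ℝ) (V : Matrix (Fin N) (Fin M) ℝ)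
    (x : Fin N → ℝ) (i : Fin M) : ℝ :=
  Real.exp (η * ∑ n, V n i * x n) / ∑ j, Real.exp (η * ∑ n, V n j * x n)

/-- The induced operator `1`-norm of a matrix `A`: `sup_{‖u‖₁ = 1} ‖A u‖₁`. -/
noncomputable def l1OpNorm {N M : ℕ} (A : Matrix (Fin N) (Fin M) ℝ) : ℝ :=
  sSup {r : ℝ | ∃ u : Fin M → ℝ, (∑ j, |u j|) = 1 ∧ r = ∑ i, |A.mulVec u i|}

/-- The leader's payoff against quantal-responding followers:
`⟨𝒴_QR(z)ᵀ Uᵀ x, g⟩ = ∑_k g_k · xᵀ U y_{V^k}(z)`. -/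
noncomputable def qrPayoff {N M K : ℕ} (η : ℝ) (U : Matrix (Fin N) (Fin M) ℝ)
    (V : Fin K → Matrix (Fin N) (Fin M) ℝ) (z x : Fin N → ℝ) (g : Fin K → ℝ) : ℝ :=
  ∑ k, g k * ∑ i, x i * ∑ j, U i j * qr η (V k) z j

/-- Paper's `b_t = ∑_{τ=1}^t a_{t−τ} = ∑_{s<t} a_s` (for `t ≥ 1`). -/
noncomputable def memB (a : ℕ → ℝ) (t : ℕ) : ℝ := ∑ s ∈ Finset.range t, a s

/-- Paper's `θ_t = (1/b_t) ∑_{τ=1}^t a_{t−τ}(t−τ) = (1/b_t) ∑_{s<t} a_s · s` (for `t ≥ 1`). -/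
noncomputable def memTheta (a : ℕ → ℝ) (t : ℕ) : ℝ :=
  (memB a t)⁻¹ * ∑ s ∈ Finset.range t, a s * s

/-- Paper's `Θ_H = ∑_{t=1}^H θ_t`. -/
noncomputable def memThetaSum (a : ℕ → ℝ) (H : ℕ) : ℝ :=
  ∑ t ∈ Finset.range H, memTheta a (t + 1)

/-- The leader's reputation `z^t`: the weighted time-average of her strategies.  With
0-indexed rounds, at round `t` (paper's round `t+1`) it is
`z = (1/b_{t+1}) ∑_{τ≤t} a_{t−τ} x^τ`. -/
noncomputable def reput {N : ℕ} (a : ℕ → ℝ) (x : ℕ → Fin N → ℝ) (t : ℕ) : Fin N → ℝ :=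
  (memB a (t + 1))⁻¹ • ∑ τ ∈ Finset.range (t + 1), a (t - τ) • x τ


open ProbabilityTheory in
lemma lint_id_exp {ν : ℝ} (hν : 0 < ν) :
    ∫⁻ x, ENNReal.ofReal x ∂(expMeasure ν) = ENNReal.ofReal (1 / ν) := by
  have hm : Measurable (gammaPDF 1 ν) := (measurable_gammaPDFReal 1 ν).ennreal_ofReal
  rw [expMeasure, gammaMeasure, lintegral_withDensity_eq_lintegral_mul _ hm
    ENNReal.measurable_ofReal]
  have : ∀ x : ℝ, (gammaPDF 1 ν * fun x => ENNReal.ofReal x) x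
      = ENNReal.ofReal (1 / ν) * gammaPDF 2 ν x := by
    intro x
    simp only [Pi.mul_apply]
    rcases lt_or_ge x 0 with hx | hx
    · rw [gammaPDF_of_neg hx, gammaPDF_of_neg hx]; simp
    · rw [gammaPDF_of_nonneg hx, gammaPDF_of_nonneg hx, ← ENNReal.ofReal_mul (by positivity),
        ← ENNReal.ofReal_mul (by positivity)]
      congr 1
      have h2 : Real.Gamma 2 = 1 := Real.Gamma_two
      rw [h2]
      norm_num
      field_simp
  simp_rw [this]
  have hm2 : Measurable (gammaPDF 2 ν) := (measurable_gammaPDFReal 2 ν).ennreal_ofReal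
  rw [lintegral_const_mul _ hm2, lintegral_gammaPDF_eq_one two_pos hν, mul_one]

open ProbabilityTheory in
lemma ae_nonneg_exp (ν : ℝ) : ∀ᵐ x ∂(expMeasure ν), 0 ≤ x := by
  rw [ae_iff]
  have : {a : ℝ | ¬ 0 ≤ a} = Set.Iio 0 := by ext; simp
  rw [this, expMeasure, gammaMeasure, withDensity_apply _ measurableSet_Iio]
  exact lintegral_gammaPDF_of_nonpos le_rfl

open ProbabilityTheory in
lemma exp_shift {ν c : ℝ} (hν : 0 < ν) (hc : 0 ≤ c) (s : Set ℝ) (hs : MeasurableSet s) :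
    (expMeasure ν) ((fun x => x + c) ⁻¹' s)
      = ENNReal.ofReal (Real.exp (ν * c)) * (expMeasure ν) (s ∩ Set.Ici c) := by
  have hp : MeasurableSet ((fun x : ℝ => x + c) ⁻¹' s) := measurable_add_const c hs
  have hsi := hs.inter (measurableSet_Ici (a := c))
  have hm : Measurable (gammaPDF 1 ν) := (measurable_gammaPDFReal 1 ν).ennreal_ofReal
  rw [expMeasure, gammaMeasure, withDensity_apply _ hp, withDensity_apply _ hsi,
    ← lintegral_indicator hp, ← lintegral_indicator hsi,
    ← lintegral_const_mul _ (hm.indicator hsi),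
    ← lintegral_add_right_eq_self (fun x => ENNReal.ofReal (Real.exp (ν * c)) * _) c]
  apply lintegral_congr
  intro x
  by_cases hx : x + c ∈ s
  · rcases lt_or_ge x 0 with h0 | h0
    · have : x + c ∉ s ∩ Set.Ici c := by simp [h0]
      rw [Set.indicator_of_notMem this, Set.indicator_of_mem (by exact hx), gammaPDF_of_neg h0]
      simp
    · have : x + c ∈ s ∩ Set.Ici c := by simp [h0, hx]
      rw [Set.indicator_of_mem this, Set.indicator_of_mem (by exact hx), gammaPDF_of_nonneg h0,
        gammaPDF_of_nonneg (by linarith), ← ENNReal.ofReal_mul (by positivity)]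
      congr 1
      simp
      have : Real.exp (-(ν * x)) = Real.exp (ν * c) * Real.exp (-(ν * (x + c))) := by
        rw [← Real.exp_add]; ring_nf
      rw [this]; ring
  · have : x + c ∉ s ∩ Set.Ici c := by simp [hx]
    rw [Set.indicator_of_notMem this, Set.indicator_of_notMem (by exact hx)]
    simp

open ProbabilityTheory in
lemma expPi_prob (N : ℕ) {ν : ℝ} (hν : 0 < ν) : IsProbabilityMeasure (expPi N ν) := by
  have := isProbabilityMeasure_expMeasure hν
  unfold expPi
  infer_instance

open ProbabilityTheory in
lemma expPi_ae (N : ℕ) {ν : ℝ} (hν : 0 < ν) : ∀ᵐ σ ∂(expPi N ν), ∀ i, 0 ≤ σ i := by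
  have := isProbabilityMeasure_expMeasure hν
  rw [ae_all_iff]
  intro i
  exact (Measure.quasiMeasurePreserving_eval
    (μ := fun _ : Fin N => expMeasure ν) i).ae (ae_nonneg_exp ν)

open ProbabilityTheory in
lemma expPi_coord (N : ℕ) {ν : ℝ} (hν : 0 < ν) (i : Fin N) :
    Integrable (fun σ => σ i) (expPi N ν) ∧ ∫ σ, σ i ∂(expPi N ν) = 1 / ν := by
  have := isProbabilityMeasure_expMeasure hν
  have hmp : MeasurePreserving (fun σ : Fin N → ℝ => σ i) (expPi N ν) (expMeasure ν) :=
    measurePreserving_eval (fun _ : Fin N => expMeasure ν) i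
  have h0 : ∀ᵐ σ ∂(expPi N ν), 0 ≤ σ i := by
    filter_upwards [expPi_ae N hν] with σ h using h i
  have hl : ∫⁻ σ, ENNReal.ofReal (σ i) ∂(expPi N ν) = ENNReal.ofReal (1 / ν) := by
    rw [← lint_id_exp hν]
    exact hmp.lintegral_comp ENNReal.measurable_ofReal
  constructor
  · refine (lintegral_ofReal_ne_top_iff_integrable (measurable_pi_apply i).aestronglyMeasurable h0).1 ?_
    rw [hl]; exact ENNReal.ofReal_ne_top
  · rw [integral_eq_lintegral_of_nonneg_ae h0 (measurable_pi_apply i).aestronglyMeasurable, hl, ENNReal.toReal_ofReal (by positivity)]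

open ProbabilityTheory in
lemma expPi_shift (N : ℕ) {ν c : ℝ} (hν : 0 < ν) (hc : 0 ≤ c) (i : Fin N) :
    (expPi N ν).map (fun σ j => σ j + if j = i then c else 0)
      = ENNReal.ofReal (Real.exp (ν * c)) • (expPi N ν).restrict {σ | c ≤ σ i} := by
  have := isProbabilityMeasure_expMeasure hν
  have h1 : (expPi N ν).map (fun σ j => σ j + if j = i then c else 0)
      = Measure.pi (fun j => (expMeasure ν).map (fun x => x + if j = i then c else 0)) := by
    have hh : ∀ j : Fin N, IsProbabilityMeasure ((expMeasure ν).map (fun x => x + if j = i then c else 0)) :=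
      fun j => Measure.isProbabilityMeasure_map (by fun_prop)
    exact Measure.pi_map_pi (μ := fun _ : Fin N => expMeasure ν)
      (f := fun j x => x + if j = i then c else 0) (fun j => by fun_prop)
  rw [h1]
  have hh : ∀ j : Fin N, IsProbabilityMeasure ((expMeasure ν).map (fun x => x + if j = i then c else 0)) :=
      fun j => Measure.isProbabilityMeasure_map (by fun_prop)
  apply Measure.pi_eq
  intro s hs
  have hset : Set.univ.pi s ∩ {σ : Fin N → ℝ | c ≤ σ i}
      = Set.univ.pi (fun j => if j = i then s j ∩ Set.Ici c else s j) := by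
    ext σ
    simp only [Set.mem_inter_iff, Set.mem_univ_pi, Set.mem_ofPred_eq]
    constructor
    · rintro ⟨h, h'⟩ j
      split_ifs with hj
      · subst hj; exact ⟨h j, h'⟩
      · exact h j
    · intro h
      refine ⟨fun j => ?_, ?_⟩
      · have := h j
        split_ifs at this with hj
        · exact this.1
        · exact this
      · have := h i
        simp at this
        exact this.2
  rw [Measure.smul_apply, Measure.restrict_apply (MeasurableSet.univ_pi hs), hset, expPi,
    Measure.pi_pi, smul_eq_mul, ← Finset.mul_prod_erase _ _ (Finset.mem_univ i),
    ← Finset.mul_prod_erase (Finset.univ) (fun j => ((expMeasure ν).map _) (s j)) (Finset.mem_univ i),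
    ← mul_assoc]
  congr 1
  · rw [Measure.map_apply (by fun_prop) (hs i)]
    simp only [if_true]
    exact (exp_shift hν hc _ (hs i)).symm
  · apply Finset.prod_congr rfl
    intro j hj
    have hj' : j ≠ i := Finset.ne_of_mem_erase hj
    simp [hj']

lemma shift_ineq (N : ℕ) {ν c : ℝ} (hν : 0 < ν) (hc : 0 ≤ c) (i : Fin N)
    (φ : (Fin N → ℝ) → ℝ) (hφ : Measurable φ) (h0 : ∀ σ, 0 ≤ φ σ) (h1 : ∀ σ, φ σ ≤ 1) :
    ∫ σ, φ (fun j => σ j + if j = i then c else 0) ∂(expPi N ν)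
      ≤ ∫ σ, φ σ ∂(expPi N ν) + ν * c := by
  have := expPi_prob N hν
  have hT : Measurable (fun (σ : Fin N → ℝ) j => σ j + if j = i then c else 0) := by fun_prop
  have hIntg : ∀ ψ : (Fin N → ℝ) → ℝ, Measurable ψ → (∀ σ, 0 ≤ ψ σ) → (∀ σ, ψ σ ≤ 1) →
      Integrable ψ (expPi N ν) := fun ψ hψ h0 h1 =>
    Integrable.of_bound hψ.aestronglyMeasurable 1 (Filter.Eventually.of_forall fun σ => by
      rw [Real.norm_eq_abs, abs_le]; constructor <;> linarith [h0 σ, h1 σ])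
  have e1 : ∫ σ, φ (fun j => σ j + if j = i then c else 0) ∂(expPi N ν)
      = Real.exp (ν * c) * ∫ σ in {σ | c ≤ σ i}, φ σ ∂(expPi N ν) := by
    rw [← integral_map (φ := fun (σ : Fin N → ℝ) j => σ j + if j = i then c else 0)
      hT.aemeasurable hφ.aestronglyMeasurable, expPi_shift N hν hc i, integral_smul_measure,
      ENNReal.toReal_ofReal (Real.exp_pos _).le, smul_eq_mul]
  have e2 : ∫ σ in {σ | c ≤ σ i}, φ σ ∂(expPi N ν) ≤ ∫ σ, φ σ ∂(expPi N ν) :=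
    setIntegral_le_integral (hIntg φ hφ h0 h1) (Filter.Eventually.of_forall h0)
  set A := ∫ σ, φ (fun j => σ j + if j = i then c else 0) ∂(expPi N ν) with hA
  have hA1 : A ≤ 1 := by
    have : A ≤ ∫ σ, (1:ℝ) ∂(expPi N ν) :=
      integral_mono (hIntg _ (hφ.comp hT) (fun _ => h0 _) (fun _ => h1 _)) (integrable_const _)
        (fun _ => h1 _)
    simpa using this
  have hA0 : 0 ≤ A := integral_nonneg fun _ => h0 _
  have e3 : Real.exp (-(ν * c)) * A ≤ ∫ σ, φ σ ∂(expPi N ν) := by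
    rw [e1, ← mul_assoc, ← Real.exp_add]; simpa using e2
  have e4 : 1 - ν * c ≤ Real.exp (-(ν * c)) := by
    have := Real.add_one_le_exp (-(ν * c)); linarith
  have hνc : 0 ≤ ν * c := by positivity
  nlinarith [mul_le_mul_of_nonneg_right e4 hA0, mul_le_mul_of_nonneg_left hA1 hνc]

lemma stability (N : ℕ) (hN : 0 < N) {ν ε D : ℝ} (hν : 0 < ν) (hD : 0 < D)
    (F F' : (Fin N → ℝ) → ℝ) (x x' : (Fin N → ℝ) → (Fin N → ℝ))
    (hx : Measurable x) (hx' : Measurable x')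
    (hs : ∀ σ, x σ ∈ stdSimplex ℝ (Fin N)) (hs' : ∀ σ, x' σ ∈ stdSimplex ℝ (Fin N))
    (hLip : ∀ y ∈ stdSimplex ℝ (Fin N), ∀ y' ∈ stdSimplex ℝ (Fin N),
      |(F' y - F y) - (F' y' - F y')| ≤ D * ∑ i, |y i - y' i|)
    (ho : ∀ σ : Fin N → ℝ, (∀ i, 0 ≤ σ i) → ∀ y ∈ stdSimplex ℝ (Fin N),
      F y + ∑ i, σ i * y i - ε ≤ F (x σ) + ∑ i, σ i * x σ i)
    (ho' : ∀ σ : Fin N → ℝ, (∀ i, 0 ≤ σ i) → ∀ y ∈ stdSimplex ℝ (Fin N),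
      F' y + ∑ i, σ i * y i - ε ≤ F' (x' σ) + ∑ i, σ i * x' σ i) :
    ∫ σ, ∑ i, |x σ i - x' σ i| ∂(expPi N ν) ≤ 4 * N ^ 2 * D * ν + 3 * ε / D := by
  have := expPi_prob N hν
  have hNr : (0:ℝ) < N := by exact_mod_cast hN
  set c : ℝ := 2 * N * D with hcdef
  have hc : 0 < c := by positivity
  have m1 : ∀ i, Measurable fun σ => x σ i := fun i => (measurable_pi_apply i).comp hx
  have m2 : ∀ i, Measurable fun σ => x' σ i := fun i => (measurable_pi_apply i).comp hx'
  have b0 : ∀ y ∈ stdSimplex ℝ (Fin N), ∀ i, 0 ≤ y i := fun y hy i => hy.1 i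
  have b1 : ∀ y ∈ stdSimplex ℝ (Fin N), ∀ i, y i ≤ 1 := fun y hy i => by
    rw [← hy.2]; exact Finset.single_le_sum (fun j _ => hy.1 j) (Finset.mem_univ i)
  have hIntg : ∀ ψ : (Fin N → ℝ) → ℝ, Measurable ψ → (∀ σ, 0 ≤ ψ σ) → (∀ σ, ψ σ ≤ 1) →
      Integrable ψ (expPi N ν) := fun ψ hψ h0 h1 =>
    Integrable.of_bound hψ.aestronglyMeasurable 1 (Filter.Eventually.of_forall fun σ => by
      rw [Real.norm_eq_abs, abs_le]; constructor <;> linarith [h0 σ, h1 σ])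
  have iabs : ∀ i, Integrable (fun σ => |x σ i - x' σ i|) (expPi N ν) := fun i =>
    hIntg _ (by have := m1 i; have := m2 i; fun_prop) (fun σ => abs_nonneg _) (fun σ => by
      rw [abs_le]; constructor <;>
        linarith [b0 _ (hs σ) i, b1 _ (hs σ) i, b0 _ (hs' σ) i, b1 _ (hs' σ) i])
  have isum : Integrable (fun σ => ∑ i, |x σ i - x' σ i|) (expPi N ν) :=
    integrable_finsetSum _ fun i _ => iabs i
  set E := ∫ σ, ∑ i, |x σ i - x' σ i| ∂(expPi N ν) with hE
  have key : ∀ i, ∫ σ, |x σ i - x' σ i| ∂(expPi N ν) ≤ ν * c + 3 * ε / c + D / c * E := by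
    intro i
    have mmin : Measurable fun σ => min (x σ i) (x' σ i) := (m1 i).min (m2 i)
    have hT : Measurable (fun (σ : Fin N → ℝ) j => σ j + if j = i then c else 0) := by fun_prop
    have n0 : ∀ σ, 0 ≤ min (x σ i) (x' σ i) := fun σ => le_min (b0 _ (hs σ) i) (b0 _ (hs' σ) i)
    have n1 : ∀ σ, min (x σ i) (x' σ i) ≤ 1 := fun σ => (min_le_left _ _).trans (b1 _ (hs σ) i)
    have sh := shift_ineq N hν hc.le i _ mmin n0 n1
    have pt : ∀ᵐ σ ∂(expPi N ν), |x σ i - x' σ i| ≤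
        (min (x (fun j => σ j + if j = i then c else 0) i)
          (x' (fun j => σ j + if j = i then c else 0) i) - min (x σ i) (x' σ i))
          + (3 * ε / c + D / c * ∑ i, |x σ i - x' σ i|) := by
      filter_upwards [expPi_ae N hν] with σ hσ
      set σ' : Fin N → ℝ := fun j => σ j + if j = i then c else 0 with hσ'
      have hσ'0 : ∀ j, 0 ≤ σ' j := fun j => by
        simp only [hσ']; have := hσ j; split_ifs <;> linarith
      have hsum : ∀ y : Fin N → ℝ, ∑ j, σ' j * y j = ∑ j, σ j * y j + c * y i := by
        intro y
        simp [hσ', add_mul, Finset.sum_add_distrib]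
      set S := ∑ i, |x σ i - x' σ i|
      have A1 := ho σ hσ _ (hs σ')
      have A2 := ho σ hσ _ (hs' σ)
      have A1' := ho' σ hσ _ (hs' σ')
      have A2' := ho' σ hσ _ (hs σ)
      have B1 := ho σ' hσ'0 _ (hs σ)
      have B2 := ho σ' hσ'0 _ (hs' σ)
      have B1' := ho' σ' hσ'0 _ (hs' σ)
      have B2' := ho' σ' hσ'0 _ (hs σ)
      simp only [hsum] at B1 B2 B1' B2'
      have LL := abs_le.1 (hLip _ (hs σ) _ (hs' σ))
      have hS0 : 0 ≤ D * S := mul_nonneg hD.le (Finset.sum_nonneg fun _ _ => abs_nonneg _)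
      have hε : 0 ≤ ε := by have := ho σ hσ _ (hs σ); linarith
      have C1 : c * (x σ' i) ≥ c * x σ i - (3 * ε + D * S) := by linarith
      have C2 : c * (x σ' i) ≥ c * x' σ i - (3 * ε + D * S) := by linarith
      have C3 : c * (x' σ' i) ≥ c * x σ i - (3 * ε + D * S) := by linarith
      have C4 : c * (x' σ' i) ≥ c * x' σ i - (3 * ε + D * S) := by linarith
      have dv : ∀ p q : ℝ, c * p ≥ c * q - (3 * ε + D * S) → q ≤ p + (3 * ε / c + D / c * S) := by
        intro p q h
        have : 3 * ε / c + D / c * S = (3 * ε + D * S) / c := by ring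
        rw [this, ← sub_le_iff_le_add', le_div_iff₀ hc]; linarith
      have C1 := dv _ _ C1
      have C2 := dv _ _ C2
      have C3 := dv _ _ C3
      have C4 := dv _ _ C4
      have habs : |x σ i - x' σ i| = max (x σ i) (x' σ i) - min (x σ i) (x' σ i) :=
        (max_sub_min_eq_abs' _ _).symm
      rw [habs]
      have : max (x σ i) (x' σ i) ≤ min (x σ' i) (x' σ' i) + (3 * ε / c + D / c * S) := by
        rw [← sub_le_iff_le_add]
        apply le_min <;> rw [sub_le_iff_le_add] <;> apply max_le <;> assumption
      linarith
    have i1 : Integrable (fun σ => min (x (fun j => σ j + if j = i then c else 0) i)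
          (x' (fun j => σ j + if j = i then c else 0) i)) (expPi N ν) :=
      hIntg _ (mmin.comp hT) (fun _ => n0 _) (fun _ => n1 _)
    have i2 := hIntg _ mmin n0 n1
    have i3 : Integrable (fun σ => 3 * ε / c + D / c * ∑ i, |x σ i - x' σ i|) (expPi N ν) :=
      (integrable_const _).add (isum.const_mul _)
    have i12 : Integrable (fun σ => min (x (fun j => σ j + if j = i then c else 0) i)
          (x' (fun j => σ j + if j = i then c else 0) i) - min (x σ i) (x' σ i)) (expPi N ν) :=
      i1.sub i2
    have := integral_mono_ae (iabs i) (i12.add i3) pt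
    simp only [Pi.add_apply] at this
    rw [integral_add i12 i3, integral_sub i1 i2, integral_add (integrable_const _)
      (isum.const_mul _), integral_const_mul, ← hE] at this
    simp at this
    linarith
  have tot : E ≤ N * (ν * c + 3 * ε / c + D / c * E) := by
    have hE2 : E = ∑ i, ∫ σ, |x σ i - x' σ i| ∂(expPi N ν) := by
      rw [hE, integral_finsetSum _ fun i _ => iabs i]
    nth_rw 1 [hE2]
    calc _ ≤ ∑ i : Fin N, (ν * c + 3 * ε / c + D / c * E) := Finset.sum_le_sum fun i _ => key i
      _ = _ := by simp; ring
  have : (N:ℝ) * (ν * c + 3 * ε / c + D / c * E) = 2 * N ^ 2 * D * ν + 3 * ε / (2 * D) + E / 2 := by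
    rw [hcdef]; field_simp
  rw [this] at tot
  have e : 3 * ε / D = 2 * (3 * ε / (2 * D)) := by field_simp
  rw [e]; linarith

lemma l1_bdd {N M : ℕ} (A : Matrix (Fin N) (Fin M) ℝ) :
    BddAbove {r : ℝ | ∃ u : Fin M → ℝ, (∑ j, |u j|) = 1 ∧ r = ∑ i, |A.mulVec u i|} := by
  refine ⟨∑ i, ∑ j, |A i j|, ?_⟩
  rintro r ⟨u, hu, rfl⟩
  apply Finset.sum_le_sum
  intro i _
  change |∑ j, A i j * u j| ≤ _
  refine (Finset.abs_sum_le_sum_abs _ _).trans (Finset.sum_le_sum fun j _ => ?_)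
  rw [abs_mul]
  have : |u j| ≤ 1 := by
    rw [← hu]; exact Finset.single_le_sum (f := fun j => |u j|) (fun k _ => abs_nonneg _) (Finset.mem_univ j)
  exact mul_le_of_le_one_right (abs_nonneg _) this

lemma l1_col {N M : ℕ} (A : Matrix (Fin N) (Fin M) ℝ) (j : Fin M) :
    ∑ i, |A i j| ≤ l1OpNorm A := by
  apply le_csSup (l1_bdd A)
  refine ⟨Pi.single j 1, ?_, ?_⟩
  · rw [Finset.sum_eq_single j] <;> simp +contextual
  · simp

lemma l1_entry {N M : ℕ} (A : Matrix (Fin N) (Fin M) ℝ) (i : Fin N) (j : Fin M) :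
    |A i j| ≤ l1OpNorm A :=
  (Finset.single_le_sum (f := fun i => |A i j|) (fun _ _ => abs_nonneg _)
    (Finset.mem_univ i)).trans (l1_col A j)

lemma qr_den_pos {N M : ℕ} (hM : 0 < M) (η : ℝ) (V : Matrix (Fin N) (Fin M) ℝ) (x : Fin N → ℝ) :
    0 < ∑ j, Real.exp (η * ∑ n, V n j * x n) :=
  Finset.sum_pos (fun _ _ => Real.exp_pos _) ⟨⟨0, hM⟩, Finset.mem_univ _⟩

lemma qr_nonneg {N M : ℕ} (hM : 0 < M) (η : ℝ) (V : Matrix (Fin N) (Fin M) ℝ) (x : Fin N → ℝ)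
    (j : Fin M) : 0 ≤ qr η V x j :=
  div_nonneg (Real.exp_pos _).le (qr_den_pos hM η V x).le

lemma qr_sum {N M : ℕ} (hM : 0 < M) (η : ℝ) (V : Matrix (Fin N) (Fin M) ℝ) (x : Fin N → ℝ) :
    ∑ j, qr η V x j = 1 := by
  unfold qr
  rw [← Finset.sum_div, div_self (qr_den_pos hM η V x).ne']

lemma qr_half {N M : ℕ} (hM : 0 < M) (η δ : ℝ) (V : Matrix (Fin N) (Fin M) ℝ)
    (z z' : Fin N → ℝ)
    (hδ : ∀ j, |η * ∑ n, V n j * z n - η * ∑ n, V n j * z' n| ≤ δ) (j : Fin M) :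
    qr η V z j - qr η V z' j ≤ 2 * δ * qr η V z j := by
  have h1 : Real.exp (-(2 * δ)) * qr η V z j ≤ qr η V z' j := by
    unfold qr
    rw [← mul_div_assoc, div_le_div_iff₀ (qr_den_pos hM η V z) (qr_den_pos hM η V z'),
      Finset.mul_sum _ (fun j => Real.exp (η * ∑ n, V n j * z' n)),
      Finset.mul_sum _ (fun j => Real.exp (η * ∑ n, V n j * z n))]
    apply Finset.sum_le_sum
    intro k _
    rw [← Real.exp_add, ← Real.exp_add, ← Real.exp_add, Real.exp_le_exp]
    have := abs_le.1 (hδ j)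
    have := abs_le.1 (hδ k)
    linarith
  have h2 := Real.add_one_le_exp (-(2 * δ))
  nlinarith [qr_nonneg hM η V z j]

lemma qr_lip {N M : ℕ} (hM : 0 < M) {η : ℝ} (hη : 0 < η) (V : Matrix (Fin N) (Fin M) ℝ)
    (z z' : Fin N → ℝ) :
    ∑ j, |qr η V z j - qr η V z' j| ≤ 4 * η * l1OpNorm V * ∑ n, |z n - z' n| := by
  set δ := η * (l1OpNorm V * ∑ n, |z n - z' n|) with hδd
  have hδ : ∀ j, |η * ∑ n, V n j * z n - η * ∑ n, V n j * z' n| ≤ δ := by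
    intro j
    rw [← mul_sub, abs_mul, abs_of_pos hη, ← Finset.sum_sub_distrib, hδd, Finset.mul_sum]
    refine mul_le_mul_of_nonneg_left ?_ hη.le
    refine (Finset.abs_sum_le_sum_abs _ _).trans (Finset.sum_le_sum fun n _ => ?_)
    rw [← mul_sub, abs_mul]
    exact mul_le_mul_of_nonneg_right (l1_entry V n j) (abs_nonneg _)
  have hδ' : ∀ j, |η * ∑ n, V n j * z' n - η * ∑ n, V n j * z n| ≤ δ := fun j => by
    rw [abs_sub_comm]; exact hδ j
  have hδ0 : 0 ≤ δ := (abs_nonneg _).trans (hδ ⟨0, hM⟩)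
  have : ∀ j, |qr η V z j - qr η V z' j| ≤ 2 * δ * (qr η V z j + qr η V z' j) := by
    intro j
    have a1 := qr_half hM η δ V z z' hδ j
    have a2 := qr_half hM η δ V z' z hδ' j
    have p1 := mul_nonneg hδ0 (qr_nonneg hM η V z j)
    have p2 := mul_nonneg hδ0 (qr_nonneg hM η V z' j)
    rw [abs_le]; constructor <;> nlinarith
  calc _ ≤ ∑ j, 2 * δ * (qr η V z j + qr η V z' j) := Finset.sum_le_sum fun j _ => this j
    _ = 4 * δ := by
      rw [← Finset.mul_sum, Finset.sum_add_distrib, qr_sum hM, qr_sum hM]; ring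
    _ = _ := by rw [hδd]; ring

lemma pay_lip_x {N M : ℕ} (hM : 0 < M) (η : ℝ)
    (U V : Matrix (Fin N) (Fin M) ℝ) (z x x' : Fin N → ℝ) :
    |∑ i, x i * ∑ j, U i j * qr η V z j - ∑ i, x' i * ∑ j, U i j * qr η V z j|
      ≤ l1OpNorm U * ∑ i, |x i - x' i| := by
  rw [← Finset.sum_sub_distrib, Finset.mul_sum]
  refine (Finset.abs_sum_le_sum_abs _ _).trans (Finset.sum_le_sum fun i _ => ?_)
  rw [← sub_mul, abs_mul, mul_comm]
  refine mul_le_mul_of_nonneg_right ?_ (abs_nonneg _)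
  calc _ ≤ ∑ j, |U i j * qr η V z j| := Finset.abs_sum_le_sum_abs _ _
    _ ≤ ∑ j, l1OpNorm U * qr η V z j := Finset.sum_le_sum fun j _ => by
        rw [abs_mul, abs_of_nonneg (qr_nonneg hM η V z j)]
        exact mul_le_mul_of_nonneg_right (l1_entry U i j) (qr_nonneg hM η V z j)
    _ = _ := by rw [← Finset.mul_sum, qr_sum hM, mul_one]

lemma pay_lip_z {N M : ℕ} (hM : 0 < M) {η : ℝ} (hη : 0 < η)
    (U V : Matrix (Fin N) (Fin M) ℝ) (hC : 0 ≤ l1OpNorm U) (z z' x : Fin N → ℝ)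
    (hx : x ∈ stdSimplex ℝ (Fin N)) :
    |∑ i, x i * ∑ j, U i j * qr η V z j - ∑ i, x i * ∑ j, U i j * qr η V z' j|
      ≤ l1OpNorm U * (4 * η * l1OpNorm V) * ∑ i, |z i - z' i| := by
  have hq := qr_lip hM hη V z z'
  rw [← Finset.sum_sub_distrib]
  calc _ ≤ ∑ i, x i * (l1OpNorm U * ∑ j, |qr η V z j - qr η V z' j|) := by
        refine (Finset.abs_sum_le_sum_abs _ _).trans (Finset.sum_le_sum fun i _ => ?_)
        rw [← mul_sub, abs_mul, abs_of_nonneg (hx.1 i)]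
        refine mul_le_mul_of_nonneg_left ?_ (hx.1 i)
        rw [← Finset.sum_sub_distrib, Finset.mul_sum]
        refine (Finset.abs_sum_le_sum_abs _ _).trans (Finset.sum_le_sum fun j _ => ?_)
        rw [← mul_sub, abs_mul]
        exact mul_le_mul_of_nonneg_right (l1_entry U i j) (abs_nonneg _)
    _ = l1OpNorm U * ∑ j, |qr η V z j - qr η V z' j| := by
        rw [← Finset.sum_mul, hx.2, one_mul]
    _ ≤ _ := by
        rw [mul_assoc]
        exact mul_le_mul_of_nonneg_left hq hC

lemma qrPayoff_cont {N M K : ℕ} (hM : 0 < M) (η : ℝ) (U : Matrix (Fin N) (Fin M) ℝ)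
    (V : Fin K → Matrix (Fin N) (Fin M) ℝ) (g : Fin K → ℝ) :
    Continuous fun y => qrPayoff η U V y y g := by
  unfold qrPayoff
  have : ∀ k j, Continuous fun y => qr η (V k) y j := by
    intro k j
    unfold qr
    exact Continuous.div (by fun_prop) (by fun_prop) (fun y => (qr_den_pos hM η (V k) y).ne')
  fun_prop

lemma qrPayoff_add {N M K : ℕ} (η : ℝ) (U : Matrix (Fin N) (Fin M) ℝ)
    (V : Fin K → Matrix (Fin N) (Fin M) ℝ) (z x : Fin N → ℝ) (n : ℕ) (g : ℕ → Fin K → ℝ) :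
    qrPayoff η U V z x (∑ τ ∈ Finset.range n, g τ)
      = ∑ τ ∈ Finset.range n, qrPayoff η U V z x (g τ) := by
  unfold qrPayoff
  rw [Finset.sum_comm]
  refine Finset.sum_congr rfl fun k _ => ?_
  rw [Finset.sum_apply, Finset.sum_mul]

lemma qrPayoff_single {N M K : ℕ} (η : ℝ) (U : Matrix (Fin N) (Fin M) ℝ)
    (V : Fin K → Matrix (Fin N) (Fin M) ℝ) (z x : Fin N → ℝ) (k : Fin K) :
    qrPayoff η U V z x (Pi.single k 1) = ∑ i, x i * ∑ j, U i j * qr η (V k) z j := by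
  unfold qrPayoff
  rw [Finset.sum_eq_single k] <;> simp +contextual

/-- Approximate measurable maximiser obtained by rounding. -/
lemma exists_approx (N : ℕ) (hN : 0 < N) (F : (Fin N → ℝ) → ℝ) (hF : Continuous F) {δ : ℝ}
    (hδ : 0 < δ) :
    ∃ x : (Fin N → ℝ) → (Fin N → ℝ), Measurable x ∧ (∀ σ, x σ ∈ stdSimplex ℝ (Fin N)) ∧
      ∀ σ, ∀ y ∈ stdSimplex ℝ (Fin N), F y + ∑ i, σ i * y i - δ ≤ F (x σ) + ∑ i, σ i * x σ i := by
  have hne : (stdSimplex ℝ (Fin N)).Nonempty :=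
    ⟨_, single_mem_stdSimplex ℝ (⟨0, hN⟩ : Fin N)⟩
  have hm : ∀ m : Fin N → ℤ, ∃ y ∈ stdSimplex ℝ (Fin N), ∀ y' ∈ stdSimplex ℝ (Fin N),
      F y' + ∑ i, (m i * δ) * y' i ≤ F y + ∑ i, (m i * δ) * y i := by
    intro m
    obtain ⟨y, hy, h⟩ := (isCompact_stdSimplex ℝ (Fin N)).exists_isMaxOn hne
      (f := fun y => F y + ∑ i, (m i * δ) * y i) (by fun_prop)
    exact ⟨y, hy, fun y' hy' => h hy'⟩
  choose p hp1 hp2 using hm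
  refine ⟨fun σ => p (fun i => ⌊σ i / δ⌋), ?_, fun σ => hp1 _, ?_⟩
  · have : Measurable p := measurable_of_countable p
    refine this.comp ?_
    refine measurable_pi_lambda _ fun i => ?_
    have h : Measurable fun σ : Fin N → ℝ => σ i / δ := by fun_prop
    exact Int.measurable_floor.comp h
  · intro σ y hy
    set m : Fin N → ℤ := fun i => ⌊σ i / δ⌋
    have h1 := hp2 m y hy
    have lo : ∀ i, (m i : ℝ) * δ ≤ σ i := fun i => by
      rw [← le_div_iff₀ hδ]; exact Int.floor_le _
    have hi : ∀ i, σ i ≤ (m i : ℝ) * δ + δ := fun i => by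
      have := (Int.lt_floor_add_one (σ i / δ)).le
      rw [div_le_iff₀ hδ] at this
      linarith
    have e1 : ∑ i, σ i * y i ≤ ∑ i, (m i * δ) * y i + δ := by
      calc _ ≤ ∑ i, ((m i * δ) * y i + δ * y i) := Finset.sum_le_sum fun i _ => by
            rw [← add_mul]; exact mul_le_mul_of_nonneg_right (hi i) (hy.1 i)
        _ = _ := by rw [Finset.sum_add_distrib, ← Finset.mul_sum, hy.2, mul_one]
    have e2 : ∑ i, (m i * δ) * p m i ≤ ∑ i, σ i * p m i :=
      Finset.sum_le_sum fun i _ => mul_le_mul_of_nonneg_right (lo i) ((hp1 m).1 i)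
    linarith

lemma reput_dist {N : ℕ} (a : ℕ → ℝ) (ha : ∀ s, 0 ≤ a s) (ha0 : 0 < a 0)
    (x : ℕ → Fin N → ℝ) (t : ℕ) :
    ∑ n, |reput a x t n - x t n| ≤
      (memB a (t + 1))⁻¹ * ∑ s ∈ Finset.range (t + 1), a s * ∑ n, |x (t - s) n - x t n| := by
  have hb : 0 < memB a (t + 1) := by
    unfold memB
    rw [Finset.sum_range_succ']
    exact add_pos_of_nonneg_of_pos (Finset.sum_nonneg fun _ _ => ha _) ha0
  have hz : ∀ n, reput a x t n
      = (memB a (t + 1))⁻¹ * ∑ s ∈ Finset.range (t + 1), a s * x (t - s) n := by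
    intro n
    unfold reput
    rw [Pi.smul_apply, smul_eq_mul, Finset.sum_apply,
      ← Finset.sum_range_reflect]
    congr 1
    refine Finset.sum_congr rfl fun s hs => ?_
    have hs' : s ≤ t := Nat.lt_succ_iff.1 (Finset.mem_range.1 hs)
    have e1 : t + 1 - 1 - s = t - s := by omega
    have e2 : t - (t - s) = s := by omega
    rw [e1, e2]; rfl
  have hpt : ∀ n, |reput a x t n - x t n| ≤
      (memB a (t + 1))⁻¹ * ∑ s ∈ Finset.range (t + 1), a s * |x (t - s) n - x t n| := by
    intro n
    have : reput a x t n - x t n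
        = (memB a (t + 1))⁻¹ * ∑ s ∈ Finset.range (t + 1), a s * (x (t - s) n - x t n) := by
      have hbd : ∑ s ∈ Finset.range (t + 1), a s = memB a (t + 1) := rfl
      rw [hz]
      simp only [mul_sub, Finset.sum_sub_distrib]
      rw [← Finset.sum_mul, hbd, ← mul_assoc, inv_mul_cancel₀ hb.ne', one_mul]
    rw [this, abs_mul, abs_of_pos (inv_pos.2 hb)]
    refine mul_le_mul_of_nonneg_left ?_ (inv_pos.2 hb).le
    refine (Finset.abs_sum_le_sum_abs _ _).trans (Finset.sum_le_sum fun s _ => ?_)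
    rw [abs_mul, abs_of_nonneg (ha s)]
  refine (Finset.sum_le_sum fun n _ => hpt n).trans (le_of_eq ?_)
  rw [← Finset.mul_sum, Finset.sum_comm]
  simp only [Finset.mul_sum]

lemma btl {N : ℕ} (f : ℕ → (Fin N → ℝ) → ℝ) (X : ℕ → Fin N → ℝ) (σ : Fin N → ℝ) (ε : ℝ) (H : ℕ)
    (hσ : ∀ i, 0 ≤ σ i) (hX : ∀ t ≤ H, X t ∈ stdSimplex ℝ (Fin N))
    (ho : ∀ t ≤ H, ∀ y ∈ stdSimplex ℝ (Fin N),
      (∑ τ ∈ Finset.range t, f τ y) + ∑ i, σ i * y i - ε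
        ≤ (∑ τ ∈ Finset.range t, f τ (X t)) + ∑ i, σ i * X t i) :
    ∀ n ≤ H, ∀ y ∈ stdSimplex ℝ (Fin N),
      (∑ τ ∈ Finset.range n, f τ y) + ∑ i, σ i * y i
        ≤ (∑ τ ∈ Finset.range n, f τ (X (τ + 1))) + n * ε + ∑ i, σ i := by
  intro n
  induction n with
  | zero =>
    intro _ y hy
    simp only [Finset.range_zero, Finset.sum_empty, Nat.cast_zero, zero_mul, zero_add]
    refine Finset.sum_le_sum fun i _ => mul_le_of_le_one_right (hσ i) ?_
    rw [← hy.2]; exact Finset.single_le_sum (fun j _ => hy.1 j) (Finset.mem_univ i)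
  | succ n ih =>
    intro hn y hy
    have h1 := ho (n + 1) hn y hy
    have h2 := ih (by omega) (X (n + 1)) (hX _ hn)
    rw [Finset.sum_range_succ (fun τ => f τ (X (n + 1)))] at h1
    rw [Finset.sum_range_succ (fun τ => f τ (X (τ + 1)))]
    push_cast
    linarith

lemma core (N : ℕ) (hN : 0 < N) (H : ℕ) {ν ε G : ℝ} (hν : 0 < ν) (hε : 0 ≤ ε) (hG : 0 < G)
    (a : ℕ → ℝ) (ha : ∀ s, 0 ≤ a s) (ha0 : 0 < a 0)
    (f : ℕ → (Fin N → ℝ) → ℝ) (X : ℕ → (Fin N → ℝ) → (Fin N → ℝ))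
    (hm : ∀ t ≤ H, Measurable (X t)) (hs : ∀ t ≤ H, ∀ σ, X t σ ∈ stdSimplex ℝ (Fin N))
    (hLip : ∀ t < H, ∀ y ∈ stdSimplex ℝ (Fin N), ∀ y' ∈ stdSimplex ℝ (Fin N),
      |f t y - f t y'| ≤ G * ∑ i, |y i - y' i|)
    (ho : ∀ σ : Fin N → ℝ, (∀ i, 0 ≤ σ i) → ∀ t ≤ H, ∀ y ∈ stdSimplex ℝ (Fin N),
      (∑ τ ∈ Finset.range t, f τ y) + ∑ i, σ i * y i - ε
        ≤ (∑ τ ∈ Finset.range t, f τ (X t σ)) + ∑ i, σ i * X t σ i)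
    (R : (Fin N → ℝ) → ℝ)
    (hR : ∀ σ : Fin N → ℝ, (∀ i, 0 ≤ σ i) → R σ ≤ (∑ i, σ i) + H * ε +
      ∑ t ∈ Finset.range H, (G * ∑ i, |X t σ i - X (t + 1) σ i| +
        G * ((memB a (t + 1))⁻¹ * ∑ s ∈ Finset.range (t + 1),
          a s * ∑ i, |X (t - s) σ i - X t σ i|))) :
    ∫ σ, R σ ∂(expPi N ν) ≤ 4 * N ^ 2 * G ^ 2 * ν * (H + memThetaSum a H) + N / ν
      + 7 * ε * H := by
  have := expPi_prob N hν
  have hNr : (0:ℝ) < N := by exact_mod_cast hN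
  have hb : ∀ t, 0 < memB a (t + 1) := by
    intro t
    unfold memB
    rw [Finset.sum_range_succ']
    exact add_pos_of_nonneg_of_pos (Finset.sum_nonneg fun _ _ => ha _) ha0
  have hTh : 0 ≤ memThetaSum a H := by
    unfold memThetaSum memTheta
    refine Finset.sum_nonneg fun t _ => mul_nonneg (inv_pos.2 (hb t)).le ?_
    exact Finset.sum_nonneg fun s _ => mul_nonneg (ha s) (Nat.cast_nonneg _)
  by_cases hRi : Integrable R (expPi N ν)
  swap
  · rw [integral_undef hRi]; positivity
  have b0 : ∀ y ∈ stdSimplex ℝ (Fin N), ∀ i, 0 ≤ y i := fun y hy i => hy.1 i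
  have b1 : ∀ y ∈ stdSimplex ℝ (Fin N), ∀ i, y i ≤ 1 := fun y hy i => by
    rw [← hy.2]; exact Finset.single_le_sum (fun j _ => hy.1 j) (Finset.mem_univ i)
  have id : ∀ t ≤ H, ∀ t' ≤ H, Integrable (fun σ => ∑ i, |X t σ i - X t' σ i|) (expPi N ν) := by
    intro t ht t' ht'
    refine integrable_finsetSum _ fun i _ => ?_
    have m1 : Measurable fun σ => X t σ i := (measurable_pi_apply i).comp (hm t ht)
    have m2 : Measurable fun σ => X t' σ i := (measurable_pi_apply i).comp (hm t' ht')
    have m3 : Measurable fun σ => |X t σ i - X t' σ i| := by fun_prop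
    refine Integrable.of_bound m3.aestronglyMeasurable 1
      (Filter.Eventually.of_forall fun σ => ?_)
    rw [Real.norm_eq_abs, abs_abs, abs_le]
    constructor <;> linarith [b0 _ (hs t ht σ) i, b1 _ (hs t ht σ) i, b0 _ (hs t' ht' σ) i,
      b1 _ (hs t' ht' σ) i]
  have pair : ∀ t s, t + s ≤ H →
      G * ∫ σ, ∑ i, |X t σ i - X (t + s) σ i| ∂(expPi N ν)
        ≤ 4 * N ^ 2 * G ^ 2 * ν * s + 3 * ε := by
    intro t s hts
    rcases Nat.eq_zero_or_pos s with rfl | hs0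
    · simp; exact hε
    have hsr : (1:ℝ) ≤ s := by exact_mod_cast hs0
    have hD : (0:ℝ) < s * G := by positivity
    have st := stability N hN (ε := ε) hν hD (fun y => ∑ τ ∈ Finset.range t, f τ y)
      (fun y => ∑ τ ∈ Finset.range (t + s), f τ y) (X t) (X (t + s)) (hm t (by omega))
      (hm _ hts) (hs t (by omega)) (hs _ hts) ?_
      (fun σ hσ => ho σ hσ t (by omega)) (fun σ hσ => ho σ hσ _ hts)
    · have := mul_le_mul_of_nonneg_left st hG.le
      refine this.trans ?_
      have e : G * (4 * (N:ℝ) ^ 2 * (s * G) * ν + 3 * ε / (s * G))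
          = 4 * N ^ 2 * G ^ 2 * ν * s + 3 * ε / s := by field_simp
      rw [e]
      have : 3 * ε / s ≤ 3 * ε := div_le_self (by positivity) hsr
      linarith
    · intro y hy y' hy'
      simp only [Finset.sum_range_add, add_sub_cancel_left]
      rw [← Finset.sum_sub_distrib]
      refine (Finset.abs_sum_le_sum_abs _ _).trans ?_
      refine (Finset.sum_le_sum fun u hu => hLip (t + u)
        (by have := Finset.mem_range.1 hu; omega) y hy y' hy').trans (le_of_eq ?_)
      simp [mul_assoc]
  have iσ : Integrable (fun σ : Fin N → ℝ => ∑ i, σ i) (expPi N ν) :=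
    integrable_finsetSum _ fun i _ => (expPi_coord N hν i).1
  have i1 : ∀ t ∈ Finset.range H,
      Integrable (fun σ => G * ∑ i, |X t σ i - X (t + 1) σ i|) (expPi N ν) := fun t ht => by
    have := Finset.mem_range.1 ht
    exact (id t (by omega) (t + 1) (by omega)).const_mul _
  have i2' : ∀ t ∈ Finset.range H, ∀ s ∈ Finset.range (t + 1),
      Integrable (fun σ => a s * ∑ i, |X (t - s) σ i - X t σ i|) (expPi N ν) := fun t ht s hs => by
    have := Finset.mem_range.1 ht
    exact (id (t - s) (by omega) t (by omega)).const_mul _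
  have i2 : ∀ t ∈ Finset.range H,
      Integrable (fun σ => G * ((memB a (t + 1))⁻¹ * ∑ s ∈ Finset.range (t + 1),
          a s * ∑ i, |X (t - s) σ i - X t σ i|)) (expPi N ν) := fun t ht =>
    ((integrable_finsetSum _ (i2' t ht)).const_mul _).const_mul _
  have i12 : ∀ t ∈ Finset.range H, Integrable (fun σ => G * ∑ i, |X t σ i - X (t + 1) σ i| +
        G * ((memB a (t + 1))⁻¹ * ∑ s ∈ Finset.range (t + 1),
          a s * ∑ i, |X (t - s) σ i - X t σ i|)) (expPi N ν) := fun t ht =>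
    (i1 t ht).add (i2 t ht)
  have iS := integrable_finsetSum _ i12
  have iA : Integrable (fun σ : Fin N → ℝ => (∑ i, σ i) + H * ε) (expPi N ν) :=
    iσ.add (integrable_const _)
  have hmono := integral_mono_ae hRi (iA.add iS) (by
    filter_upwards [expPi_ae N hν] with σ hσ using hR σ hσ)
  refine hmono.trans ?_
  simp only [Pi.add_apply]
  rw [integral_add iA iS, integral_add iσ (integrable_const _), integral_finsetSum _ i12,
    integral_finsetSum _ fun i _ => (expPi_coord N hν i).1]
  simp only [fun i => (expPi_coord N hν i).2]
  have ht : ∀ t ∈ Finset.range H, ∫ σ, (G * ∑ i, |X t σ i - X (t + 1) σ i| +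
        G * ((memB a (t + 1))⁻¹ * ∑ s ∈ Finset.range (t + 1),
          a s * ∑ i, |X (t - s) σ i - X t σ i|)) ∂(expPi N ν)
      ≤ 4 * N ^ 2 * G ^ 2 * ν * (1 + memTheta a (t + 1)) + 6 * ε := by
    intro t ht
    have htH := Finset.mem_range.1 ht
    rw [integral_add (i1 t ht) (i2 t ht), integral_const_mul, integral_const_mul,
      integral_const_mul, integral_finsetSum _ (i2' t ht)]
    have p1 := pair t 1 (by omega)
    have p2 : G * ((memB a (t + 1))⁻¹ * ∑ s ∈ Finset.range (t + 1),
        ∫ σ, a s * ∑ i, |X (t - s) σ i - X t σ i| ∂(expPi N ν))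
        ≤ 4 * N ^ 2 * G ^ 2 * ν * memTheta a (t + 1) + 3 * ε := by
      have q : ∑ s ∈ Finset.range (t + 1),
          G * ∫ σ, a s * ∑ i, |X (t - s) σ i - X t σ i| ∂(expPi N ν)
          ≤ ∑ s ∈ Finset.range (t + 1), (4 * N ^ 2 * G ^ 2 * ν * (a s * s) + a s * (3 * ε)) := by
        refine Finset.sum_le_sum fun s hs => ?_
        have hst := Finset.mem_range.1 hs
        have := pair (t - s) s (by omega)
        rw [Nat.sub_add_cancel (by omega)] at this
        rw [integral_const_mul]
        have := mul_le_mul_of_nonneg_left this (ha s)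
        linarith
      have hbd : ∑ s ∈ Finset.range (t + 1), a s = memB a (t + 1) := rfl
      rw [← Finset.mul_sum, Finset.sum_add_distrib, ← Finset.mul_sum, ← Finset.sum_mul,
        hbd] at q
      have := mul_le_mul_of_nonneg_left q (inv_pos.2 (hb t)).le
      unfold memTheta
      have e : (memB a (t + 1))⁻¹ * (memB a (t + 1) * (3 * ε)) = 3 * ε := by
        rw [← mul_assoc, inv_mul_cancel₀ (hb t).ne', one_mul]
      rw [mul_add, e] at this
      linarith
    push_cast at p1
    linarith
  have hfin := Finset.sum_le_sum ht
  rw [Finset.sum_add_distrib, ← Finset.mul_sum, Finset.sum_add_distrib, ← memThetaSum] at hfin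
  simp at hfin ⊢
  have : (N:ℝ) * ν⁻¹ = N / ν := by rw [div_eq_mul_inv]
  linarith

/-- **Regret bound of FTPL against quantal-responding followers with memory
(general perturbation rate ν).**  Leader payoff matrix `U ≥ 0`; follower payoff matrices
`V^1, …, V^K` with `L = 2η max_k ‖V^k‖₁`; nonnegative memory weights `a` with `a 0 > 0`;
follower types `g^1, …, g^H ∈ {e_1,…,e_K}` with partial sums `G^t`; `σ` has i.i.d.
exponential(ν) coordinates; the decision `x^t(σ) ∈ Δ_N` is an `ε`-approximate maximizer of
`x ↦ ⟨𝒴_QR(x)ᵀUᵀx, G^{t−1}⟩ + ⟨σ, x⟩` over `Δ_N` for every `σ ≥ 0` (0-indexed: round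
`t < H` uses `G t = ∑_{τ<t} g τ`).  Then
`E[max_{x∈Δ_N} ⟨𝒴_QR(x)ᵀUᵀx, G^H⟩ − ∑_t ⟨𝒴_QR(z^t)ᵀUᵀx^t, g^t⟩]
  ≤ 50νN²‖U‖₁²(1+L)²(H+Θ_H) + N/ν + ε(13H+1)`. -/
theorem stmt9 {N M K : ℕ} (hN : 0 < N) (hM : 0 < M) (hK : 0 < K)
    (H : ℕ) (hH : 0 < H)
    (ε ν η : ℝ) (hε : 0 ≤ ε) (hν : 0 < ν) (hη : 0 < η)
    (U : Matrix (Fin N) (Fin M) ℝ) (hU : ∀ i j, 0 ≤ U i j)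
    (V : Fin K → Matrix (Fin N) (Fin M) ℝ) (L : ℝ)
    (hL : L = 2 * η * Finset.univ.sup' (Finset.univ_nonempty_iff.mpr ⟨⟨0, hK⟩⟩)
      (fun k => l1OpNorm (V k)))
    (a : ℕ → ℝ) (ha : ∀ s, 0 ≤ a s) (ha0 : 0 < a 0)
    (g : ℕ → Fin K → ℝ) (hg : ∀ t < H, ∃ k, g t = Pi.single k 1)
    (x : ℕ → (Fin N → ℝ) → (Fin N → ℝ)) (hxmeas : ∀ t, Measurable (x t))
    (hxsimplex : ∀ t < H, ∀ σ : Fin N → ℝ, (∀ i, 0 ≤ σ i) → x t σ ∈ stdSimplex ℝ (Fin N))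
    (hOracle : ∀ σ : Fin N → ℝ, (∀ i, 0 ≤ σ i) → ∀ t < H,
      sSup ((fun y => qrPayoff η U V y y (∑ τ ∈ Finset.range t, g τ) + ∑ i, σ i * y i) ''
          stdSimplex ℝ (Fin N)) - ε ≤
        qrPayoff η U V (x t σ) (x t σ) (∑ τ ∈ Finset.range t, g τ) + ∑ i, σ i * x t σ i) :
    (∫ σ, (sSup ((fun y => qrPayoff η U V y y (∑ τ ∈ Finset.range H, g τ)) ''
          stdSimplex ℝ (Fin N))
        - ∑ t ∈ Finset.range H,
            qrPayoff η U V (reput a (fun τ => x τ σ) t) (x t σ) (g t))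
      ∂(expPi N ν)) ≤
      50 * ν * N ^ 2 * l1OpNorm U ^ 2 * (1 + L) ^ 2 * (H + memThetaSum a H)
        + N / ν + ε * (13 * H + 1) := by
  have hUr : ∀ i j, U i j ≤ l1OpNorm U := fun i j => (le_abs_self _).trans (l1_entry U i j)
  have hC : 0 ≤ l1OpNorm U := (abs_nonneg _).trans (l1_entry U ⟨0, hN⟩ ⟨0, hM⟩)
  have hVL : ∀ k, 2 * η * l1OpNorm (V k) ≤ L := fun k => by
    rw [hL]
    exact mul_le_mul_of_nonneg_left
      (Finset.le_sup' (fun k => l1OpNorm (V k)) (Finset.mem_univ k)) (by positivity)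
  have hV0 : ∀ k, 0 ≤ l1OpNorm (V k) := fun k =>
    (abs_nonneg _).trans (l1_entry (V k) ⟨0, hN⟩ ⟨0, hM⟩)
  have hL0 : 0 ≤ L := le_trans (mul_nonneg (by positivity) (hV0 ⟨0, hK⟩)) (hVL ⟨0, hK⟩)
  have hNr : (0:ℝ) < N := by exact_mod_cast hN
  have hne : (stdSimplex ℝ (Fin N)).Nonempty :=
    ⟨_, single_mem_stdSimplex ℝ (⟨0, hN⟩ : Fin N)⟩
  have hb : ∀ t, 0 < memB a (t + 1) := by
    intro t
    unfold memB
    rw [Finset.sum_range_succ']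
    exact add_pos_of_nonneg_of_pos (Finset.sum_nonneg fun _ _ => ha _) ha0
  have hTh : 0 ≤ memThetaSum a H := by
    unfold memThetaSum memTheta
    refine Finset.sum_nonneg fun t _ => mul_nonneg (inv_pos.2 (hb t)).le ?_
    exact Finset.sum_nonneg fun s _ => mul_nonneg (ha s) (Nat.cast_nonneg _)
  rcases hC.eq_or_lt with hC0 | hCpos
  · have hU0 : ∀ i j, U i j = 0 := fun i j => le_antisymm (by rw [hC0]; exact hUr i j) (hU i j)
    have hp : ∀ z y (g : Fin K → ℝ), qrPayoff η U V z y g = 0 := by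
      intro z y g
      simp [qrPayoff, hU0]
    simp only [hp, Finset.sum_const_zero, hne.image_const, csSup_singleton, sub_zero,
      integral_zero]
    positivity
  set G : ℝ := 2 * l1OpNorm U * (1 + L) with hG
  have hGpos : 0 < G := by positivity
  set δ : ℝ := ν * N ^ 2 * l1OpNorm U ^ 2 * (1 + L) ^ 2 with hδ
  have hδpos : 0 < δ := by positivity
  -- Lipschitz estimates
  have lipz : ∀ t < H, ∀ z z', ∀ y ∈ stdSimplex ℝ (Fin N),
      |qrPayoff η U V z y (g t) - qrPayoff η U V z' y (g t)|
        ≤ (2 * l1OpNorm U * L) * ∑ i, |z i - z' i| := by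
    intro t ht z z' y hy
    obtain ⟨k, hk⟩ := hg t ht
    rw [hk, qrPayoff_single, qrPayoff_single]
    refine (pay_lip_z hM hη U (V k) hC z z' y hy).trans ?_
    refine mul_le_mul_of_nonneg_right ?_ (Finset.sum_nonneg fun _ _ => abs_nonneg _)
    have := mul_le_mul_of_nonneg_left (hVL k) hC
    linarith
  have lipx : ∀ t < H, ∀ z y y',
      |qrPayoff η U V z y (g t) - qrPayoff η U V z y' (g t)|
        ≤ l1OpNorm U * ∑ i, |y i - y' i| := by
    intro t ht z y y'
    obtain ⟨k, hk⟩ := hg t ht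
    rw [hk, qrPayoff_single, qrPayoff_single]
    exact pay_lip_x hM η U (V k) z y y'
  have lip : ∀ t < H, ∀ y ∈ stdSimplex ℝ (Fin N), ∀ y' ∈ stdSimplex ℝ (Fin N),
      |qrPayoff η U V y y (g t) - qrPayoff η U V y' y' (g t)| ≤ G * ∑ i, |y i - y' i| := by
    intro t ht y _ y' hy'
    have h1 := abs_le.1 (lipx t ht y y y')
    have h2 := abs_le.1 (lipz t ht y y' y' hy')
    have h3 : 0 ≤ l1OpNorm U * ∑ i, |y i - y' i| :=
      mul_nonneg hC (Finset.sum_nonneg fun _ _ => abs_nonneg _)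
    rw [hG, abs_le]
    constructor <;> linarith
  -- extended strategies
  obtain ⟨w, hw1, hw2, hw3⟩ := exists_approx N hN _
    (qrPayoff_cont hM η U V (∑ τ ∈ Finset.range H, g τ)) hδpos
  set X : ℕ → (Fin N → ℝ) → (Fin N → ℝ) :=
    fun t σ => if t < H then x t (fun i => max (σ i) 0) else w σ with hX
  have hXlt : ∀ σ : Fin N → ℝ, (∀ i, 0 ≤ σ i) → ∀ t < H, X t σ = x t σ := by
    intro σ hσ t ht
    have : (fun i => max (σ i) 0) = σ := funext fun i => max_eq_left (hσ i)
    simp only [hX, ht, if_true, this]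
  have hXm : ∀ t ≤ H, Measurable (X t) := by
    intro t _
    by_cases h : t < H
    · simp only [hX, h, if_true]
      exact (hxmeas t).comp (by fun_prop)
    · simp only [hX, h, if_false]
      exact hw1
  have hXs : ∀ t ≤ H, ∀ σ, X t σ ∈ stdSimplex ℝ (Fin N) := by
    intro t _ σ
    by_cases h : t < H
    · simp only [hX, h, if_true]
      exact hxsimplex t h _ fun i => le_max_right _ _
    · simp only [hX, h, if_false]
      exact hw2 σ
  have hXo : ∀ σ : Fin N → ℝ, (∀ i, 0 ≤ σ i) → ∀ t ≤ H, ∀ y ∈ stdSimplex ℝ (Fin N),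
      (∑ τ ∈ Finset.range t, qrPayoff η U V y y (g τ)) + ∑ i, σ i * y i - (ε + δ)
        ≤ (∑ τ ∈ Finset.range t, qrPayoff η U V (X t σ) (X t σ) (g τ))
          + ∑ i, σ i * X t σ i := by
    intro σ hσ t ht y hy
    rw [← qrPayoff_add, ← qrPayoff_add]
    rcases ht.lt_or_eq with h | rfl
    · rw [hXlt σ hσ t h]
      have h1 := hOracle σ hσ t h
      have hcont : Continuous fun y =>
          qrPayoff η U V y y (∑ τ ∈ Finset.range t, g τ) + ∑ i, σ i * y i :=
        (qrPayoff_cont hM η U V _).add (by fun_prop)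
      have h2 := le_csSup ((isCompact_stdSimplex ℝ (Fin N)).bddAbove_image hcont.continuousOn)
        (Set.mem_image_of_mem _ hy)
      linarith
    · have : X t σ = w σ := by simp [hX]
      rw [this]
      have := hw3 σ y hy
      linarith
  have main := core N hN H hν (by positivity : 0 ≤ ε + δ) hGpos a ha ha0
    (fun t y => qrPayoff η U V y y (g t)) X hXm hXs lip hXo
    (fun σ => sSup ((fun y => qrPayoff η U V y y (∑ τ ∈ Finset.range H, g τ)) ''
          stdSimplex ℝ (Fin N))
        - ∑ t ∈ Finset.range H,
            qrPayoff η U V (reput a (fun τ => x τ σ) t) (x t σ) (g t)) ?_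
  · refine main.trans ?_
    have hH1 : (0:ℝ) ≤ H := Nat.cast_nonneg _
    have e1 : 4 * (N:ℝ) ^ 2 * G ^ 2 * ν * (H + memThetaSum a H)
        = 16 * (δ * (H + memThetaSum a H)) := by rw [hG, hδ]; ring
    have e2 : 50 * ν * (N:ℝ) ^ 2 * l1OpNorm U ^ 2 * (1 + L) ^ 2 * (H + memThetaSum a H)
        = 50 * (δ * (H + memThetaSum a H)) := by rw [hδ]; ring
    rw [e1, e2]
    have p1 : 0 ≤ δ * memThetaSum a H := by positivity
    have p2 : 0 ≤ δ * H := by positivity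
    have p3 : 0 ≤ ε * H := by positivity
    nlinarith
  · intro σ hσ
    have hB := btl (fun t y => qrPayoff η U V y y (g t)) (fun t => X t σ) σ (ε + δ) H hσ
      (fun t ht => hXs t ht σ) (hXo σ hσ) H le_rfl
    have hsup : sSup ((fun y => qrPayoff η U V y y (∑ τ ∈ Finset.range H, g τ)) ''
          stdSimplex ℝ (Fin N)) ≤ (∑ τ ∈ Finset.range H,
            qrPayoff η U V (X (τ + 1) σ) (X (τ + 1) σ) (g τ)) + H * (ε + δ) + ∑ i, σ i := by
      apply csSup_le (hne.image _)
      rintro _ ⟨y, hy, rfl⟩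
      have := hB y hy
      have hp : 0 ≤ ∑ i, σ i * y i := Finset.sum_nonneg fun i _ => mul_nonneg (hσ i) (hy.1 i)
      simp only [qrPayoff_add]
      linarith
    have hstep : ∀ t ∈ Finset.range H,
        qrPayoff η U V (X (t + 1) σ) (X (t + 1) σ) (g t)
          - qrPayoff η U V (reput a (fun τ => x τ σ) t) (x t σ) (g t) ≤
        G * ∑ i, |X t σ i - X (t + 1) σ i| +
        G * ((memB a (t + 1))⁻¹ * ∑ s ∈ Finset.range (t + 1),
          a s * ∑ i, |X (t - s) σ i - X t σ i|) := by
      intro t ht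
      have htH := Finset.mem_range.1 ht
      have hr : reput a (fun τ => x τ σ) t = reput a (fun τ => X τ σ) t := by
        unfold reput
        congr 1
        refine Finset.sum_congr rfl fun τ hτ => ?_
        have := Finset.mem_range.1 hτ
        change a (t - τ) • x τ σ = a (t - τ) • X τ σ
        rw [hXlt σ hσ τ (by omega)]
      rw [hr, ← hXlt σ hσ t htH]
      have h1 := abs_le.1 (lip t htH _ (hXs t htH.le σ) _ (hXs (t + 1) htH σ))
      have h2 := abs_le.1 (lipz t htH (reput a (fun τ => X τ σ) t) (X t σ) _ (hXs t htH.le σ))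
      have h3 := reput_dist a ha ha0 (fun τ => X τ σ) t
      have h4 : (2 * l1OpNorm U * L) * ∑ i, |reput a (fun τ => X τ σ) t i - X t σ i|
          ≤ G * ((memB a (t + 1))⁻¹ * ∑ s ∈ Finset.range (t + 1),
          a s * ∑ i, |X (t - s) σ i - X t σ i|) := by
        refine mul_le_mul ?_ h3 (Finset.sum_nonneg fun _ _ => abs_nonneg _) hGpos.le
        rw [hG]; nlinarith
      linarith
    have := Finset.sum_le_sum hstep
    rw [Finset.sum_sub_distrib] at this
    linarith
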